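/- Error equation for the full discretization with the mixed Ritz/L₂-projected splitting (equation (6.8) of the paper). Let q ≥ 0, let (u₁,u₂) be the exact solution, let U ∈ 𝒱_{h,q} be the dG(q)–cG(r) approximation, and set θ₁ := U₁ − Π_k R_h u₁, θ₂ := U₂ − Π_k P_h u₂, η₁ := (Π_k − I) R_h u₁, η₂ := (Π_k − I) P_h u₂, ω₂ := (P_h − I) u₂. Then for every V = (V₁,V₂) ∈ 𝒱_{h,q}, B(θ,V) = Σ_{n=1}^N ∫_{I_n} ( a(η₂,V₁) − a(η₁,V₂) ) dt + Σ_{n=1}^N ∫_{I_n} a(ω₂,V₁) dt. -/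

import Mathlib

noncomputable section

open scoped RealInnerProductSpace BigOperators
open MeasureTheory

/-- Squared fractional-order norm `‖v‖_α² = Σ_k λ_k^α (v,φ_k)²`. -/
def hsNormSq {H : Type*} [NormedAddCommGroup H] [InnerProductSpace ℝ H]
    (φ : ℕ → H) (lam : ℕ → ℝ) (α : ℝ) (v : H) : ℝ :=
  ∑' k, lam k ^ α * ⟪v, φ k⟫ ^ 2

/-- Fractional-order norm `‖v‖_α`. -/
def hsNorm {H : Type*} [NormedAddCommGroup H] [InnerProductSpace ℝ H]
    (φ : ℕ → H) (lam : ℕ → ℝ) (α : ℝ) (v : H) : ℝ :=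
  Real.sqrt (hsNormSq φ lam α v)

/-- Membership in the fractional-order space `Ḣ^α`. -/
def MemHs {H : Type*} [NormedAddCommGroup H] [InnerProductSpace ℝ H]
    (φ : ℕ → H) (lam : ℕ → ℝ) (α : ℝ) (v : H) : Prop :=
  Summable (fun k => lam k ^ α * ⟪v, φ k⟫ ^ 2)

/-- Weighted spectral pairing `Σ_k λ_k^l (u,φ_k)(v,φ_k)`.
`aPow φ lam 1 u v = a(u,v)`, `aPow φ lam (l+1) u v = a(u, A^l v)` and
`aPow φ lam l u v = (u, A^l v)`. -/
def aPow {H : Type*} [NormedAddCommGroup H] [InnerProductSpace ℝ H]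
    (φ : ℕ → H) (lam : ℕ → ℝ) (l : ℝ) (u v : H) : ℝ :=
  ∑' k, lam k ^ l * ⟪u, φ k⟫ * ⟪v, φ k⟫

/-- The energy bilinear form `a(u,v) = Σ_k λ_k (u,φ_k)(v,φ_k)`. -/
def aForm {H : Type*} [NormedAddCommGroup H] [InnerProductSpace ℝ H]
    (φ : ℕ → H) (lam : ℕ → ℝ) (u v : H) : ℝ :=
  aPow φ lam 1 u v

/-- The operator `A`, determined by `A φ_k = λ_k φ_k`. -/
def Aop {H : Type*} [NormedAddCommGroup H] [InnerProductSpace ℝ H]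
    (φ : ℕ → H) (lam : ℕ → ℝ) (v : H) : H :=
  ∑' k, (lam k * ⟪v, φ k⟫) • φ k

/-- Value at time `s` of the polynomial of degree ≤ q (with coefficients `c n ·`)
attached to the `n`-th time subinterval. -/
def pval {H : Type*} [NormedAddCommGroup H] [InnerProductSpace ℝ H]
    (q : ℕ) (c : ℕ → ℕ → H) (n : ℕ) (s : ℝ) : H :=
  ∑ j ∈ Finset.range (q + 1), s ^ j • c n j

/-- Time derivative of `pval`. -/
def pderiv {H : Type*} [NormedAddCommGroup H] [InnerProductSpace ℝ H]
    (q : ℕ) (c : ℕ → ℕ → H) (n : ℕ) (s : ℝ) : H :=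
  ∑ j ∈ Finset.range (q + 1), ((j : ℝ) * s ^ (j - 1)) • c n j

/-- The dG bilinear form `B((u₁,u₂),(v₁,v₂))`, where the piecewise polynomials
`u₁, u₂, v₁, v₂` are described by their coefficient families `c1, c2, d1, d2`
(on the mesh `0 = tt 0 < tt 1 < ⋯ < tt N`). -/
def Bform {H : Type*} [NormedAddCommGroup H] [InnerProductSpace ℝ H]
    (φ : ℕ → H) (lam : ℕ → ℝ) (tt : ℕ → ℝ) (N q : ℕ)
    (c1 c2 d1 d2 : ℕ → ℕ → H) : ℝ :=
  (∑ n ∈ Finset.Icc 1 N, ∫ s in tt (n-1)..tt n,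
      (aForm φ lam (pderiv q c1 n s) (pval q d1 n s)
        - aForm φ lam (pval q c2 n s) (pval q d1 n s)
        + ⟪pderiv q c2 n s, pval q d2 n s⟫
        + aForm φ lam (pval q c1 n s) (pval q d2 n s)))
  + (∑ n ∈ Finset.Icc 1 (N-1),
      (aForm φ lam (pval q c1 (n+1) (tt n) - pval q c1 n (tt n)) (pval q d1 (n+1) (tt n))
        + ⟪pval q c2 (n+1) (tt n) - pval q c2 n (tt n), pval q d2 (n+1) (tt n)⟫))
  + aForm φ lam (pval q c1 1 (tt 0)) (pval q d1 1 (tt 0))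
  + ⟪pval q c2 1 (tt 0), pval q d2 1 (tt 0)⟫

/-- Supremum of `g` over the open interval `(a,b)`. -/
def supIoo (g : ℝ → ℝ) (a b : ℝ) : ℝ :=
  sSup (g '' Set.Ioo a b)

/-- Squared discrete fractional norm `‖v‖_{h,s}² = ‖A_h^{s/2} v‖²`, expressed through
an orthonormal eigenbasis `e` of `A_h` on `S_h` with eigenvalues `μ`. -/
def hNormSqh {H : Type*} [NormedAddCommGroup H] [InnerProductSpace ℝ H]
    {m : ℕ} (e : Fin m → H) (μ : Fin m → ℝ) (s : ℝ) (v : H) : ℝ :=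
  ∑ i, μ i ^ s * ⟪v, e i⟫ ^ 2

/-- Discrete fractional norm `‖v‖_{h,s}`. -/
def hNormh {H : Type*} [NormedAddCommGroup H] [InnerProductSpace ℝ H]
    {m : ℕ} (e : Fin m → H) (μ : Fin m → ℝ) (s : ℝ) (v : H) : ℝ :=
  Real.sqrt (hNormSqh e μ s v)

/-- Discrete weighted pairing: `aPowh e μ (l+1) u v = a(u, A_h^l v)` and
`aPowh e μ l u v = (u, A_h^l v)` for `u, v ∈ S_h`. -/
def aPowh {H : Type*} [NormedAddCommGroup H] [InnerProductSpace ℝ H]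
    {m : ℕ} (e : Fin m → H) (μ : Fin m → ℝ) (l : ℝ) (u v : H) : ℝ :=
  ∑ i, μ i ^ l * ⟪u, e i⟫ * ⟪v, e i⟫

section SpectralForm

variable {H : Type*} [NormedAddCommGroup H] [InnerProductSpace ℝ H] {φ : ℕ → H} {lam : ℕ → ℝ}

theorem memHs_zero (hφ : Orthonormal ℝ φ) (v : H) : MemHs φ lam 0 v := by
  have h := hφ.inner_products_summable v
  simpa [MemHs, real_inner_comm] using h

theorem MemHs.of_le {α β : ℝ} (hαβ : α ≤ β) (hpos : ∀ k, 0 < lam k) (hmono : Monotone lam) {v : H}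
    (hv : MemHs φ lam β v) : MemHs φ lam α v := by
  refine Summable.of_nonneg_of_le (fun k => ?_) (fun k => ?_) (hv.mul_left (lam 0 ^ (α - β)))
  · have := hpos k
    positivity
  · have hk := hpos k
    have h : lam k ^ α ≤ lam 0 ^ (α - β) * lam k ^ β := by
      calc lam k ^ α = lam k ^ (α - β) * lam k ^ β := by
            rw [← Real.rpow_add hk, sub_add_cancel]
        _ ≤ _ := by
            gcongr ?_ * _
            exact Real.rpow_le_rpow_of_nonpos (hpos 0) (hmono (Nat.zero_le k)) (by linarith)
    rw [← mul_assoc]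
    gcongr

theorem weight_mul_inner_eq {α β : ℝ} (hαβ : α + β = 2) (hpos : ∀ k, 0 < lam k) (u v : H) (k : ℕ) :
    lam k ^ (1 : ℝ) * ⟪u, φ k⟫ * ⟪v, φ k⟫
      = (lam k ^ (α / 2) * ⟪u, φ k⟫) * (lam k ^ (β / 2) * ⟪v, φ k⟫) := by
  have h : lam k ^ (1 : ℝ) = lam k ^ (α / 2) * lam k ^ (β / 2) := by
    rw [← Real.rpow_add (hpos k)]
    congr 1
    linarith
  rw [h]
  ring

theorem sq_half_weight (hpos : ∀ k, 0 < lam k) (α : ℝ) (u : H) (k : ℕ) :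
    (lam k ^ (α / 2) * ⟪u, φ k⟫) ^ 2 = lam k ^ α * ⟪u, φ k⟫ ^ 2 := by
  rw [mul_pow, ← Real.rpow_mul_natCast (hpos k).le]
  norm_num

theorem MemHs.summable_pairing {α β : ℝ} (hαβ : α + β = 2) (hpos : ∀ k, 0 < lam k) {u v : H}
    (hu : MemHs φ lam α u) (hv : MemHs φ lam β v) :
    Summable fun k => lam k ^ (1 : ℝ) * ⟪u, φ k⟫ * ⟪v, φ k⟫ := by
  refine Summable.of_norm_bounded (hu.add hv) (fun k => ?_)
  rw [weight_mul_inner_eq hαβ hpos, ← sq_half_weight hpos α, ← sq_half_weight hpos β,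
    Real.norm_eq_abs, abs_le]
  constructor <;>
    nlinarith [sq_nonneg (lam k ^ (α / 2) * ⟪u, φ k⟫ + lam k ^ (β / 2) * ⟪v, φ k⟫),
      sq_nonneg (lam k ^ (α / 2) * ⟪u, φ k⟫ - lam k ^ (β / 2) * ⟪v, φ k⟫),
      sq_nonneg (lam k ^ (α / 2) * ⟪u, φ k⟫), sq_nonneg (lam k ^ (β / 2) * ⟪v, φ k⟫)]

theorem MemHs.sum_le_hsNorm_sq {α : ℝ} (hpos : ∀ k, 0 < lam k) {u : H} (hu : MemHs φ lam α u)
    (s : Finset ℕ) : ∑ k ∈ s, (lam k ^ (α / 2) * ⟪u, φ k⟫) ^ 2 ≤ hsNorm φ lam α u ^ 2 := by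
  have h0 : ∀ k, 0 ≤ lam k ^ α * ⟪u, φ k⟫ ^ 2 := fun k => by
    have := hpos k
    positivity
  rw [hsNorm, hsNormSq, Real.sq_sqrt (tsum_nonneg h0)]
  simp_rw [sq_half_weight hpos]
  exact hu.sum_le_tsum s fun k _ => h0 k

/-- The spectral truncation of `A v` to the first `K` modes. -/
def truncA (φ : ℕ → H) (lam : ℕ → ℝ) (v : H) (K : ℕ) : H :=
  ∑ k ∈ Finset.range K, (lam k ^ (1 : ℝ) * ⟪v, φ k⟫) • φ k

theorem inner_truncA (w v : H) (K : ℕ) :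
    ⟪w, truncA φ lam v K⟫ = ∑ k ∈ Finset.range K, lam k ^ (1 : ℝ) * ⟪w, φ k⟫ * ⟪v, φ k⟫ := by
  rw [truncA, inner_sum]
  refine Finset.sum_congr rfl fun k _ => ?_
  rw [real_inner_smul_right]
  ring

theorem abs_inner_truncA_le {α β : ℝ} (hαβ : α + β = 2) (hpos : ∀ k, 0 < lam k) {u v : H}
    (hu : MemHs φ lam α u) (hv : MemHs φ lam β v) (K : ℕ) :
    |⟪u, truncA φ lam v K⟫| ≤ hsNorm φ lam α u * hsNorm φ lam β v := by
  rw [inner_truncA]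
  simp_rw [weight_mul_inner_eq hαβ hpos]
  refine abs_le_of_sq_le_sq ?_ (mul_nonneg (Real.sqrt_nonneg _) (Real.sqrt_nonneg _))
  rw [mul_pow]
  refine (Finset.sum_mul_sq_le_sq_mul_sq _ _ _).trans ?_
  exact mul_le_mul (hu.sum_le_hsNorm_sq hpos _) (hv.sum_le_hsNorm_sq hpos _)
    (Finset.sum_nonneg fun _ _ => sq_nonneg _) (sq_nonneg _)

theorem tendsto_inner_truncA {α β : ℝ} (hαβ : α + β = 2) (hpos : ∀ k, 0 < lam k) {u v : H}
    (hu : MemHs φ lam α u) (hv : MemHs φ lam β v) :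
    Filter.Tendsto (fun K => ⟪u, truncA φ lam v K⟫) Filter.atTop (nhds (aForm φ lam u v)) := by
  simp_rw [inner_truncA]
  exact (hu.summable_pairing hαβ hpos hv).hasSum.tendsto_sum_nat

theorem aForm_comm (u v : H) : aForm φ lam u v = aForm φ lam v u :=
  tsum_congr fun k => by ring

theorem aForm_smul_left (c : ℝ) (u v : H) :
    aForm φ lam (c • u) v = c * aForm φ lam u v := by
  unfold aForm aPow
  rw [← tsum_mul_left]
  refine tsum_congr fun k => ?_
  rw [real_inner_smul_left]
  ring

theorem aForm_add_left (hpos : ∀ k, 0 < lam k) {u v w : H} (hu : MemHs φ lam 1 u)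
    (hv : MemHs φ lam 1 v) (hw : MemHs φ lam 1 w) :
    aForm φ lam (u + v) w = aForm φ lam u w + aForm φ lam v w := by
  unfold aForm aPow
  rw [← (hu.summable_pairing (by norm_num) hpos hw).tsum_add
    (hv.summable_pairing (by norm_num) hpos hw)]
  refine tsum_congr fun k => ?_
  rw [inner_add_left]
  ring

theorem aForm_sub_left (hpos : ∀ k, 0 < lam k) {u v w : H} (hu : MemHs φ lam 1 u)
    (hv : MemHs φ lam 1 v) (hw : MemHs φ lam 1 w) :
    aForm φ lam (u - v) w = aForm φ lam u w - aForm φ lam v w := by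
  unfold aForm aPow
  rw [← (hu.summable_pairing (by norm_num) hpos hw).tsum_sub
    (hv.summable_pairing (by norm_num) hpos hw)]
  refine tsum_congr fun k => ?_
  rw [inner_sub_left]
  ring

theorem aForm_pval_right (hpos : ∀ k, 0 < lam k) {w : H} (hw : MemHs φ lam 1 w) (q : ℕ)
    {d : ℕ → ℕ → H} {n : ℕ} (hd : ∀ j, MemHs φ lam 1 (d n j)) (s : ℝ) :
    aForm φ lam w (pval q d n s) = ∑ j ∈ Finset.range (q + 1), s ^ j * aForm φ lam w (d n j) := by
  unfold aForm aPow pval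
  simp_rw [← tsum_mul_left]
  rw [← Summable.tsum_finsetSum fun j _ =>
    (hw.summable_pairing (by norm_num) hpos (hd j)).mul_left (s ^ j)]
  refine tsum_congr fun k => ?_
  rw [sum_inner, Finset.mul_sum]
  refine Finset.sum_congr rfl fun j _ => ?_
  rw [real_inner_smul_left]
  ring

theorem inner_pval_right (w : H) (q : ℕ) (d : ℕ → ℕ → H) (n : ℕ) (s : ℝ) :
    ⟪w, pval q d n s⟫ = ∑ j ∈ Finset.range (q + 1), s ^ j * ⟪w, d n j⟫ := by
  unfold pval
  rw [inner_sum]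
  exact Finset.sum_congr rfl fun j _ => real_inner_smul_right _ _ _

theorem inner_Aop [CompleteSpace H] (hφ : Orthonormal ℝ φ)
    (hφtotal : (Submodule.span ℝ (Set.range φ)).topologicalClosure = ⊤)
    {v : H} (hv : MemHs φ lam 2 v) (χ : H) : ⟪Aop φ lam v, χ⟫ = aForm φ lam v χ := by
  have hmem : Memℓp (fun k => lam k * ⟪v, φ k⟫) 2 := by
    rw [memℓp_gen_iff (by norm_num)]
    refine hv.congr fun k => ?_
    simp [mul_pow]
  let b : HilbertBasis ℕ ℝ H := HilbertBasis.mk hφ hφtotal.ge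
  have hsum : Summable fun k => (lam k * ⟪v, φ k⟫) • φ k := by
    have h := (b.hasSum_repr_symm ⟨_, hmem⟩).summable
    simpa [b] using h
  have h := (hsum.hasSum.mapL (innerSL ℝ χ)).tsum_eq
  rw [real_inner_comm, Aop, ← innerSL_apply_apply ℝ, ← h]
  refine tsum_congr fun k => ?_
  simp

theorem eq_zero_of_aForm_self
    (hφtotal : (Submodule.span ℝ (Set.range φ)).topologicalClosure = ⊤) (hpos : ∀ k, 0 < lam k)
    {v : H} (hv : MemHs φ lam 1 v) (h : aForm φ lam v v = 0) : v = 0 := by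
  have hterm : ∀ k, 0 ≤ lam k ^ (1 : ℝ) * ⟪v, φ k⟫ * ⟪v, φ k⟫ := fun k => by
    rw [mul_assoc]
    exact mul_nonneg (Real.rpow_nonneg (hpos k).le _) (mul_self_nonneg _)
  have hs := hv.summable_pairing (by norm_num) hpos hv
  have hzero := (hs.hasSum_iff.2 h)
  rw [hasSum_zero_iff_of_nonneg hterm] at hzero
  have hdense : Dense (Submodule.span ℝ (Set.range φ) : Set H) := by
    rw [Submodule.dense_iff_topologicalClosure_eq_top]
    exact hφtotal
  refine hdense.eq_zero_of_inner_left ℝ fun w hw => ?_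
  induction hw using Submodule.span_induction with
  | mem x hx =>
    obtain ⟨k, rfl⟩ := hx
    have hk := congrFun hzero k
    have := (hpos k).ne'
    simpa [this] using hk
  | zero => simp
  | add x y _ _ hx hy => rw [inner_add_right, hx, hy, add_zero]
  | smul c x _ hx => rw [real_inner_smul_right, hx, mul_zero]

/-- On a finite-dimensional subspace the energy form is represented by an invertible operator. -/
theorem exists_discrete_operator
    (hφtotal : (Submodule.span ℝ (Set.range φ)).topologicalClosure = ⊤) (hpos : ∀ k, 0 < lam k)
    (S : Submodule ℝ H) [FiniteDimensional ℝ S] (hSV : ∀ v ∈ S, MemHs φ lam 1 v) :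
    ∃ A : S →ₗ[ℝ] S, Function.Surjective A ∧
      ∀ w χ : S, aForm φ lam w χ = ⟪(w : H), (A χ : H)⟫ := by
  let F : S →ₗ[ℝ] S →ₗ[ℝ] ℝ := LinearMap.mk₂ ℝ (fun χ w => aForm φ lam χ w)
    (fun x y z => aForm_add_left hpos (hSV _ x.2) (hSV _ y.2) (hSV _ z.2))
    (fun c x z => aForm_smul_left c _ _)
    (fun x y z => by
      rw [aForm_comm, aForm_comm _ (y : H), aForm_comm _ (z : H)]
      exact aForm_add_left hpos (hSV _ y.2) (hSV _ z.2) (hSV _ x.2))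
    (fun c x z => by
      rw [aForm_comm, aForm_comm _ (z : H)]
      exact aForm_smul_left c _ _)
  let A : S →ₗ[ℝ] S := (InnerProductSpace.toDual ℝ S).symm.toLinearEquiv.toLinearMap ∘ₗ
    LinearMap.toContinuousLinearMap.toLinearMap ∘ₗ F
  have hA : ∀ w χ : S, aForm φ lam w χ = ⟪(w : H), (A χ : H)⟫ := fun w χ => by
    rw [← Submodule.coe_inner, real_inner_comm, aForm_comm]
    exact (InnerProductSpace.toDual_symm_apply (𝕜 := ℝ) (x := w)
      (y := LinearMap.toContinuousLinearMap (F χ))).symm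
  refine ⟨A, LinearMap.injective_iff_surjective.1 ?_, hA⟩
  rw [← LinearMap.ker_eq_bot, LinearMap.ker_eq_bot']
  intro χ hχ
  have h := hA χ χ
  rw [hχ] at h
  exact Subtype.ext (eq_zero_of_aForm_self hφtotal hpos (hSV _ χ.2) (by simpa using h))

end SpectralForm

section TimeIntegration

variable {H : Type*} [NormedAddCommGroup H] [InnerProductSpace ℝ H] {φ : ℕ → H} {lam : ℕ → ℝ}

theorem continuous_pval (q : ℕ) (c : ℕ → ℕ → H) (n : ℕ) : Continuous (pval q c n) := by
  unfold pval
  fun_prop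

theorem continuous_pderiv (q : ℕ) (c : ℕ → ℕ → H) (n : ℕ) : Continuous (pderiv q c n) := by
  unfold pderiv
  fun_prop

theorem hasDerivAt_pval (q : ℕ) (c : ℕ → ℕ → H) (n : ℕ) (s : ℝ) :
    HasDerivAt (pval q c n) (pderiv q c n s) s := by
  unfold pval pderiv
  exact HasDerivAt.fun_sum fun j _ => (hasDerivAt_pow j s).smul_const (c n j)

theorem intervalIntegrable_aForm {α β : ℝ} (hαβ : α + β = 2) (hpos : ∀ k, 0 < lam k)
    {a b : ℝ} (hab : a ≤ b) {w : ℝ → H} (hwc : ContinuousOn w (Set.Icc a b))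
    (hw : ∀ t, MemHs φ lam α (w t))
    (hwi : IntervalIntegrable (fun t => hsNorm φ lam α (w t)) volume a b)
    {χ : H} (hχ : MemHs φ lam β χ) :
    IntervalIntegrable (fun s => aForm φ lam (w s) χ) volume a b := by
  refine (hwi.mul_const (hsNorm φ lam β χ)).mono_fun' ?_ ?_
  · refine aestronglyMeasurable_of_tendsto_ae Filter.atTop
      (f := fun K s => ⟪w s, truncA φ lam χ K⟫) (fun K => ?_)
      (Filter.Eventually.of_forall fun s => tendsto_inner_truncA hαβ hpos (hw s) hχ)
    rw [Set.uIoc_of_le hab]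
    exact ((hwc.inner continuousOn_const).mono Set.Ioc_subset_Icc_self).aestronglyMeasurable
      measurableSet_Ioc
  · refine Filter.Eventually.of_forall fun s => ?_
    exact le_of_tendsto (tendsto_inner_truncA hαβ hpos (hw s) hχ).abs
      (Filter.Eventually.of_forall fun K => abs_inner_truncA_le hαβ hpos (hw s) hχ K)

theorem tendsto_integral_inner_truncA {α β : ℝ} (hαβ : α + β = 2) (hpos : ∀ k, 0 < lam k)
    {a b : ℝ} (hab : a ≤ b) {w : ℝ → H} (hwc : ContinuousOn w (Set.Icc a b))
    (hw : ∀ t, MemHs φ lam α (w t))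
    (hwi : IntervalIntegrable (fun t => hsNorm φ lam α (w t)) volume a b)
    {χ : H} (hχ : MemHs φ lam β χ) {p : ℝ → ℝ} (hp : Continuous p) :
    Filter.Tendsto (fun K => ∫ s in a..b, p s * ⟪w s, truncA φ lam χ K⟫) Filter.atTop
      (nhds (∫ s in a..b, p s * aForm φ lam (w s) χ)) := by
  refine intervalIntegral.tendsto_integral_filter_of_dominated_convergence
    (fun s => |p s| * (hsNorm φ lam α (w s) * hsNorm φ lam β χ))
    (Filter.Eventually.of_forall fun K => ?_)
    (Filter.Eventually.of_forall fun K => Filter.Eventually.of_forall fun s _ => ?_)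
    ((hwi.mul_const _).continuousOn_mul hp.abs.continuousOn)
    (Filter.Eventually.of_forall fun s _ => ?_)
  · rw [Set.uIoc_of_le hab]
    exact (hp.continuousOn.mul ((hwc.inner continuousOn_const).mono
      Set.Ioc_subset_Icc_self)).aestronglyMeasurable measurableSet_Ioc
  · rw [Real.norm_eq_abs, abs_mul]
    exact mul_le_mul_of_nonneg_left (abs_inner_truncA_le hαβ hpos (hw s) hχ K) (abs_nonneg _)
  · exact (tendsto_inner_truncA hαβ hpos (hw s) hχ).const_mul _

/-- Integration by parts against a monomial in time. -/
theorem integral_pow_mul_eq_sub {a b : ℝ} (hab : a ≤ b) {y y' : ℝ → ℝ}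
    (hyc : ContinuousOn y (Set.Icc a b)) (hy : ∀ s ∈ Set.Ioo a b, HasDerivAt y (y' s) s)
    (hy' : IntervalIntegrable y' volume a b) (j : ℕ) :
    ∫ s in a..b, s ^ j * y' s
      = b ^ j * y b - a ^ j * y a - ∫ s in a..b, (j * s ^ (j - 1)) * y s := by
  have hyi : IntervalIntegrable y volume a b :=
    ContinuousOn.intervalIntegrable (by rwa [Set.uIcc_of_le hab])
  have h1 : IntervalIntegrable (fun s : ℝ => (j * s ^ (j - 1)) * y s) volume a b :=
    hyi.continuousOn_mul (Continuous.continuousOn (by fun_prop))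
  have h2 : IntervalIntegrable (fun s : ℝ => s ^ j * y' s) volume a b :=
    hy'.continuousOn_mul (Continuous.continuousOn (by fun_prop))
  have h := intervalIntegral.integral_eq_sub_of_hasDerivAt_of_le (f := fun s => s ^ j * y s) hab
    ((continuous_pow j).continuousOn.mul hyc)
    (fun s hs => (hasDerivAt_pow j s).mul (hy s hs)) (h1.add h2)
  rw [intervalIntegral.integral_add h1 h2] at h
  linarith

theorem integral_pow_mul_aForm_eq_sub (hpos : ∀ k, 0 < lam k)
    {a b : ℝ} (hab : a ≤ b) {α β : ℝ} (hαβ : α + β = 2) {u v : ℝ → H}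
    (huc : ContinuousOn u (Set.Icc a b)) (hvc : ContinuousOn v (Set.Icc a b))
    (huv : ∀ s ∈ Set.Ioo a b, HasDerivAt u (v s) s)
    (hu : ∀ t, MemHs φ lam α (u t)) (hv : ∀ t, MemHs φ lam 1 (v t))
    (hui : IntervalIntegrable (fun t => hsNorm φ lam α (u t)) volume a b)
    (hvi : IntervalIntegrable (fun t => hsNorm φ lam 1 (v t)) volume a b)
    {χ : H} (hχβ : MemHs φ lam β χ) (hχ : MemHs φ lam 1 χ) (j : ℕ) :
    ∫ s in a..b, s ^ j * aForm φ lam (v s) χ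
      = b ^ j * aForm φ lam (u b) χ - a ^ j * aForm φ lam (u a) χ
        - ∫ s in a..b, (j * s ^ (j - 1)) * aForm φ lam (u s) χ := by
  refine tendsto_nhds_unique
    (tendsto_integral_inner_truncA (by norm_num) hpos hab hvc hv hvi hχ (continuous_pow j)) ?_
  have hlim := (((tendsto_inner_truncA hαβ hpos (hu b) hχβ).const_mul (b ^ j)).sub
    ((tendsto_inner_truncA hαβ hpos (hu a) hχβ).const_mul (a ^ j))).sub
    (tendsto_integral_inner_truncA hαβ hpos hab huc hu hui hχβ
      (p := fun s : ℝ => (j * s ^ (j - 1) : ℝ)) (by fun_prop))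
  refine hlim.congr fun K => (integral_pow_mul_eq_sub hab (huc.inner continuousOn_const)
    (fun s hs => ?_) (ContinuousOn.intervalIntegrable ?_) j).symm
  · simpa using (huv s hs).inner ℝ (hasDerivAt_const s (truncA φ lam χ K))
  · rw [Set.uIcc_of_le hab]
    exact hvc.inner continuousOn_const

/-- One-interval identity for the interpolant `pval q c n` of `R`, tested with polynomials: the
derivative of the interpolant plus its initial jump reproduces the derivative of `R`. -/
theorem integral_pderiv_add_jump_eq [CompleteSpace H] {a b : ℝ} (hab : a ≤ b) (q : ℕ)
    (c : ℕ → ℕ → H) (n : ℕ)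
    {R : ℝ → H} (hRi : IntervalIntegrable R volume a b) (hnode : pval q c n b = R b)
    (horth : ∀ j ∈ Finset.range q, (∫ s in a..b, (s ^ j) • (pval q c n s - R s)) = 0)
    (z : ℕ → H) (y' : ℕ → ℝ → ℝ) (hy'i : ∀ j, IntervalIntegrable (y' j) volume a b)
    (hibp : ∀ j, ∫ s in a..b, s ^ j * y' j s
      = b ^ j * ⟪R b, z j⟫ - a ^ j * ⟪R a, z j⟫ - ∫ s in a..b, (j * s ^ (j - 1)) * ⟪R s, z j⟫) :
    (∫ s in a..b, ∑ j ∈ Finset.range (q + 1), s ^ j * ⟪pderiv q c n s, z j⟫)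
        + ∑ j ∈ Finset.range (q + 1), a ^ j * ⟪pval q c n a - R a, z j⟫
      = ∫ s in a..b, ∑ j ∈ Finset.range (q + 1), s ^ j * y' j s := by
  have hc := continuous_pval q c n
  have hc' := continuous_pderiv q c n
  rw [intervalIntegral.integral_finsetSum fun j _ =>
      Continuous.intervalIntegrable (by fun_prop) a b,
    intervalIntegral.integral_finsetSum fun j _ =>
      (hy'i j).continuousOn_mul (continuous_pow j).continuousOn, ← Finset.sum_add_distrib]
  refine Finset.sum_congr rfl fun j hj => ?_
  have hparts := integral_pow_mul_eq_sub hab (y := fun s => ⟪pval q c n s, z j⟫)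
    (y' := fun s => ⟪pderiv q c n s, z j⟫) (Continuous.continuousOn (by fun_prop))
    (fun s _ => by simpa using (hasDerivAt_pval q c n s).inner ℝ (hasDerivAt_const s (z j)))
    (Continuous.intervalIntegrable (by fun_prop) a b) j
  have hdiff : IntervalIntegrable (fun s => pval q c n s - R s) volume a b :=
    (hc.intervalIntegrable a b).sub hRi
  have hker : ∫ s in a..b, (j * s ^ (j - 1)) * ⟪pval q c n s - R s, z j⟫ = 0 := by
    rcases Nat.eq_zero_or_pos j with rfl | hj0
    · simp
    have h0 := horth (j - 1) (by simp at hj ⊢; omega)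
    have hcomm := (innerSL ℝ (z j)).intervalIntegral_comp_comm
      (hdiff.continuousOn_smul (continuous_pow (j - 1)).continuousOn)
    rw [h0, map_zero] at hcomm
    simp_rw [mul_assoc]
    rw [intervalIntegral.integral_const_mul]
    convert mul_zero (j : ℝ)
    rw [← hcomm]
    refine intervalIntegral.integral_congr fun s _ => ?_
    simp [real_inner_comm]
  have hinner : ∀ {g : ℝ → H}, IntervalIntegrable g volume a b →
      IntervalIntegrable (fun s : ℝ => (j * s ^ (j - 1)) * ⟪g s, z j⟫) volume a b := by
    intro g hg
    refine IntervalIntegrable.continuousOn_mul ?_ (Continuous.continuousOn (by fun_prop))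
    rw [intervalIntegrable_iff] at hg ⊢
    exact hg.inner_const (z j)
  simp_rw [inner_sub_left, mul_sub] at hker
  rw [intervalIntegral.integral_sub (hinner (hc.intervalIntegrable a b)) (hinner hRi)] at hker
  rw [hparts, hibp, hnode, inner_sub_left]
  linarith

end TimeIntegration

section DiscreteSpace

variable {H : Type*} [NormedAddCommGroup H] [InnerProductSpace ℝ H] {φ : ℕ → H} {lam : ℕ → ℝ}

theorem sum_Icc_one_succ_eq (g : ℕ → ℝ) (M : ℕ) :
    ∑ n ∈ Finset.Icc 1 (M + 1), g n = g 1 + ∑ n ∈ Finset.Icc 1 M, g (n + 1) := by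
  induction M with
  | zero => simp
  | succ M ih =>
    rw [Finset.sum_Icc_succ_top (by omega), ih, Finset.sum_Icc_succ_top (by omega), add_assoc]

theorem pval_mem {S : Submodule ℝ H} {c : ℕ → ℕ → H} (hc : ∀ n j, c n j ∈ S) (q n : ℕ) (s : ℝ) :
    pval q c n s ∈ S :=
  S.sum_mem fun j _ => S.smul_mem _ (hc n j)

theorem pderiv_mem {S : Submodule ℝ H} {c : ℕ → ℕ → H} (hc : ∀ n j, c n j ∈ S) (q n : ℕ) (s : ℝ) :
    pderiv q c n s ∈ S :=
  S.sum_mem fun j _ => S.smul_mem _ (hc n j)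

theorem pval_sub (q : ℕ) (c e : ℕ → ℕ → H) (n : ℕ) (s : ℝ) :
    pval q (fun n j => c n j - e n j) n s = pval q c n s - pval q e n s := by
  simp only [pval, smul_sub, Finset.sum_sub_distrib]

theorem pderiv_sub (q : ℕ) (c e : ℕ → ℕ → H) (n : ℕ) (s : ℝ) :
    pderiv q (fun n j => c n j - e n j) n s = pderiv q c n s - pderiv q e n s := by
  simp only [pderiv, smul_sub, Finset.sum_sub_distrib]

theorem intervalIntegrable_inner_pval {a b : ℝ} {g : ℝ → H} (hg : IntervalIntegrable g volume a b)
    (q : ℕ) (d : ℕ → ℕ → H) (n : ℕ) :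
    IntervalIntegrable (fun s => ⟪g s, pval q d n s⟫) volume a b := by
  simp_rw [inner_pval_right, ← Finset.sum_fn]
  refine IntervalIntegrable.sum _ fun j _ => ?_
  refine IntervalIntegrable.continuousOn_mul ?_ (continuous_pow j).continuousOn
  rw [intervalIntegrable_iff] at hg ⊢
  exact hg.inner_const _

theorem intervalIntegrable_aForm_pval (hpos : ∀ k, 0 < lam k) {a b : ℝ} {w : ℝ → H}
    (hw : ∀ s, MemHs φ lam 1 (w s)) (q : ℕ) {d : ℕ → ℕ → H} {n : ℕ}
    (hd : ∀ j, MemHs φ lam 1 (d n j))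
    (hwi : ∀ j, IntervalIntegrable (fun s => aForm φ lam (w s) (d n j)) volume a b) :
    IntervalIntegrable (fun s => aForm φ lam (w s) (pval q d n s)) volume a b := by
  simp_rw [fun s => aForm_pval_right hpos (hw s) q hd s, ← Finset.sum_fn]
  exact IntervalIntegrable.sum _ fun j _ =>
    (hwi j).continuousOn_mul (continuous_pow j).continuousOn

theorem intervalIntegrable_aForm_pval_of_mem
    (hφtotal : (Submodule.span ℝ (Set.range φ)).topologicalClosure = ⊤) (hpos : ∀ k, 0 < lam k)
    {S : Submodule ℝ H} [FiniteDimensional ℝ S] (hSV : ∀ v ∈ S, MemHs φ lam 1 v) {a b : ℝ}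
    {g : ℝ → H} (hgS : ∀ s, g s ∈ S) (hg : IntervalIntegrable g volume a b) (q : ℕ)
    {d : ℕ → ℕ → H} (hd : ∀ n j, d n j ∈ S) (n : ℕ) :
    IntervalIntegrable (fun s => aForm φ lam (g s) (pval q d n s)) volume a b := by
  obtain ⟨A, -, hA⟩ := exists_discrete_operator hφtotal hpos S hSV
  refine intervalIntegrable_aForm_pval hpos (fun s => hSV _ (hgS s)) q
    (fun j => hSV _ (hd n j)) fun j => ?_
  simp_rw [fun s => hA ⟨g s, hgS s⟩ ⟨d n j, hd n j⟩]
  rw [intervalIntegrable_iff] at hg ⊢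
  exact hg.inner_const _

/-- A function with values in a finite-dimensional space is integrable as soon as its energy
pairings with all elements of that space are. -/
theorem intervalIntegrable_of_aForm
    (hφtotal : (Submodule.span ℝ (Set.range φ)).topologicalClosure = ⊤) (hpos : ∀ k, 0 < lam k)
    {S : Submodule ℝ H} [FiniteDimensional ℝ S] (hSV : ∀ v ∈ S, MemHs φ lam 1 v) {a b : ℝ}
    {g : ℝ → H} (hgS : ∀ s, g s ∈ S)
    (hg : ∀ χ ∈ S, IntervalIntegrable (fun s => aForm φ lam (g s) χ) volume a b) :
    IntervalIntegrable g volume a b := by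
  obtain ⟨A, hAsurj, hA⟩ := exists_discrete_operator hφtotal hpos S hSV
  let e := stdOrthonormalBasis ℝ S
  have hexp : g = ∑ i, fun s => ⟪g s, (e i : H)⟫ • (e i : H) := by
    ext s
    have h := congrArg (Subtype.val) (e.sum_repr' ⟨g s, hgS s⟩)
    simpa [Finset.sum_apply, real_inner_comm] using h.symm
  rw [hexp]
  refine IntervalIntegrable.sum _ fun i _ => ?_
  obtain ⟨χ, hχ⟩ := hAsurj (e i)
  have h := hg χ χ.2
  simp_rw [fun s => hA ⟨g s, hgS s⟩ χ, hχ] at h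
  rw [intervalIntegrable_iff] at h ⊢
  exact h.smul_const _

theorem Bform_sub_left
    (hφtotal : (Submodule.span ℝ (Set.range φ)).topologicalClosure = ⊤) (hpos : ∀ k, 0 < lam k)
    {S : Submodule ℝ H} [FiniteDimensional ℝ S] (hSV : ∀ v ∈ S, MemHs φ lam 1 v)
    (tt : ℕ → ℝ) (N q : ℕ) {c1 c2 e1 e2 d1 d2 : ℕ → ℕ → H}
    (hc1 : ∀ n j, c1 n j ∈ S) (hc2 : ∀ n j, c2 n j ∈ S)
    (he1 : ∀ n j, e1 n j ∈ S) (he2 : ∀ n j, e2 n j ∈ S)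
    (hd1 : ∀ n j, d1 n j ∈ S) (hd2 : ∀ n j, d2 n j ∈ S) :
    Bform φ lam tt N q (fun n j => c1 n j - e1 n j) (fun n j => c2 n j - e2 n j) d1 d2
      = Bform φ lam tt N q c1 c2 d1 d2 - Bform φ lam tt N q e1 e2 d1 d2 := by
  have hint : ∀ {x1 x2 : ℕ → ℕ → H}, (∀ n j, x1 n j ∈ S) → (∀ n j, x2 n j ∈ S) → ∀ n,
      IntervalIntegrable (fun s => aForm φ lam (pderiv q x1 n s) (pval q d1 n s)
        - aForm φ lam (pval q x2 n s) (pval q d1 n s)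
        + ⟪pderiv q x2 n s, pval q d2 n s⟫
        + aForm φ lam (pval q x1 n s) (pval q d2 n s)) volume (tt (n - 1)) (tt n) := by
    intro x1 x2 hx1 hx2 n
    refine IntervalIntegrable.add (IntervalIntegrable.add (IntervalIntegrable.sub ?_ ?_) ?_) ?_
    · exact intervalIntegrable_aForm_pval_of_mem hφtotal hpos hSV (pderiv_mem hx1 q n)
        ((continuous_pderiv q x1 n).intervalIntegrable _ _) q hd1 n
    · exact intervalIntegrable_aForm_pval_of_mem hφtotal hpos hSV (pval_mem hx2 q n)
        ((continuous_pval q x2 n).intervalIntegrable _ _) q hd1 n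
    · exact intervalIntegrable_inner_pval ((continuous_pderiv q x2 n).intervalIntegrable _ _) _ _ _
    · exact intervalIntegrable_aForm_pval_of_mem hφtotal hpos hSV (pval_mem hx1 q n)
        ((continuous_pval q x1 n).intervalIntegrable _ _) q hd2 n
  have hsub : ∀ {x y z : H}, x ∈ S → y ∈ S → z ∈ S →
      aForm φ lam (x - y) z = aForm φ lam x z - aForm φ lam y z := fun hx hy hz =>
    aForm_sub_left hpos (hSV _ hx) (hSV _ hy) (hSV _ hz)
  have hI : ∀ n, (∫ s in tt (n-1)..tt n,
      (aForm φ lam (pderiv q (fun n j => c1 n j - e1 n j) n s) (pval q d1 n s)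
        - aForm φ lam (pval q (fun n j => c2 n j - e2 n j) n s) (pval q d1 n s)
        + ⟪pderiv q (fun n j => c2 n j - e2 n j) n s, pval q d2 n s⟫
        + aForm φ lam (pval q (fun n j => c1 n j - e1 n j) n s) (pval q d2 n s)))
      = (∫ s in tt (n-1)..tt n, (aForm φ lam (pderiv q c1 n s) (pval q d1 n s)
        - aForm φ lam (pval q c2 n s) (pval q d1 n s)
        + ⟪pderiv q c2 n s, pval q d2 n s⟫
        + aForm φ lam (pval q c1 n s) (pval q d2 n s)))
      - ∫ s in tt (n-1)..tt n, (aForm φ lam (pderiv q e1 n s) (pval q d1 n s)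
        - aForm φ lam (pval q e2 n s) (pval q d1 n s)
        + ⟪pderiv q e2 n s, pval q d2 n s⟫
        + aForm φ lam (pval q e1 n s) (pval q d2 n s)) := by
    intro n
    rw [← intervalIntegral.integral_sub (hint hc1 hc2 n) (hint he1 he2 n)]
    refine intervalIntegral.integral_congr fun s _ => ?_
    simp only [pval_sub, pderiv_sub]
    rw [hsub (pderiv_mem hc1 q n s) (pderiv_mem he1 q n s) (pval_mem hd1 q n s),
      hsub (pval_mem hc2 q n s) (pval_mem he2 q n s) (pval_mem hd1 q n s),
      hsub (pval_mem hc1 q n s) (pval_mem he1 q n s) (pval_mem hd2 q n s), inner_sub_left]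
    ring
  have hJ : ∀ n, aForm φ lam (pval q (fun n j => c1 n j - e1 n j) (n+1) (tt n)
        - pval q (fun n j => c1 n j - e1 n j) n (tt n)) (pval q d1 (n+1) (tt n))
      = aForm φ lam (pval q c1 (n+1) (tt n) - pval q c1 n (tt n)) (pval q d1 (n+1) (tt n))
      - aForm φ lam (pval q e1 (n+1) (tt n) - pval q e1 n (tt n)) (pval q d1 (n+1) (tt n)) := by
    intro n
    rw [← hsub (S.sub_mem (pval_mem hc1 _ _ _) (pval_mem hc1 _ _ _))
      (S.sub_mem (pval_mem he1 _ _ _) (pval_mem he1 _ _ _)) (pval_mem hd1 _ _ _),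
      pval_sub, pval_sub]
    congr 1
    abel
  have hK : ∀ n, ⟪pval q (fun n j => c2 n j - e2 n j) (n+1) (tt n)
        - pval q (fun n j => c2 n j - e2 n j) n (tt n), pval q d2 (n+1) (tt n)⟫
      = ⟪pval q c2 (n+1) (tt n) - pval q c2 n (tt n), pval q d2 (n+1) (tt n)⟫
      - ⟪pval q e2 (n+1) (tt n) - pval q e2 n (tt n), pval q d2 (n+1) (tt n)⟫ := by
    intro n
    rw [← inner_sub_left, pval_sub, pval_sub]
    congr 1
    abel
  unfold Bform
  simp_rw [hI, hJ, hK, Finset.sum_add_distrib, Finset.sum_sub_distrib]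
  rw [pval_sub, pval_sub, inner_sub_left,
    hsub (pval_mem hc1 _ _ _) (pval_mem he1 _ _ _) (pval_mem hd1 _ _ _)]
  ring

/-- The contribution of one time interval to `B` evaluated at the interpolants of the projected
exact solution. -/
theorem interval_consistency [CompleteSpace H] (hφ : Orthonormal ℝ φ)
    (hφtotal : (Submodule.span ℝ (Set.range φ)).topologicalClosure = ⊤)
    (hpos : ∀ k, 0 < lam k) (hmono : Monotone lam) (q : ℕ) {a b : ℝ} (hab : a ≤ b)
    {S : Submodule ℝ H} [FiniteDimensional ℝ S] (hSV : ∀ v ∈ S, MemHs φ lam 1 v)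
    {Rh Ph : H → H} (hRh_mem : ∀ v, Rh v ∈ S)
    (hRh : ∀ v, MemHs φ lam 1 v → ∀ χ ∈ S, aForm φ lam (Rh v - v) χ = 0)
    (hPh_mem : ∀ v, Ph v ∈ S) (hPh : ∀ v, ∀ χ ∈ S, ⟪Ph v - v, χ⟫ = 0)
    {f : ℝ → H} (hf : IntervalIntegrable f volume a b) {u1 u2 : ℝ → H}
    (hu1c : ContinuousOn u1 (Set.Icc a b)) (hu2c : ContinuousOn u2 (Set.Icc a b))
    (hu1H2 : ∀ t, MemHs φ lam 2 (u1 t)) (hu2V : ∀ t, MemHs φ lam 1 (u2 t))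
    (hu1H2i : IntervalIntegrable (fun t => hsNorm φ lam 2 (u1 t)) volume a b)
    (hu2Vi : IntervalIntegrable (fun t => hsNorm φ lam 1 (u2 t)) volume a b)
    (hode1 : ∀ t ∈ Set.Ioo a b, HasDerivAt u1 (u2 t) t)
    (hode2 : ∀ t ∈ Set.Ioo a b, HasDerivAt u2 (f t - Aop φ lam (u1 t)) t)
    {P1 P2 d1 d2 : ℕ → ℕ → H} (hP1S : ∀ n j, P1 n j ∈ S) (hP2S : ∀ n j, P2 n j ∈ S)
    (hd1 : ∀ n j, d1 n j ∈ S) (hd2 : ∀ n j, d2 n j ∈ S) (n : ℕ)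
    (hP1node : pval q P1 n b = Rh (u1 b)) (hP2node : pval q P2 n b = Ph (u2 b))
    (hP1orth : ∀ j ∈ Finset.range q,
      (∫ s in a..b, (s ^ j) • (pval q P1 n s - Rh (u1 s))) = 0)
    (hP2orth : ∀ j ∈ Finset.range q,
      (∫ s in a..b, (s ^ j) • (pval q P2 n s - Ph (u2 s))) = 0) :
    (∫ s in a..b, (aForm φ lam (pderiv q P1 n s) (pval q d1 n s)
        - aForm φ lam (pval q P2 n s) (pval q d1 n s)
        + ⟪pderiv q P2 n s, pval q d2 n s⟫
        + aForm φ lam (pval q P1 n s) (pval q d2 n s)))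
      + (aForm φ lam (pval q P1 n a - Rh (u1 a)) (pval q d1 n a)
        + ⟪pval q P2 n a - Ph (u2 a), pval q d2 n a⟫)
    = (∫ s in a..b, ⟪f s, pval q d2 n s⟫)
      - (∫ s in a..b, (aForm φ lam (pval q P2 n s - Ph (u2 s)) (pval q d1 n s)
          - aForm φ lam (pval q P1 n s - Rh (u1 s)) (pval q d2 n s)))
      - ∫ s in a..b, aForm φ lam (Ph (u2 s) - u2 s) (pval q d1 n s) := by
  obtain ⟨A, -, hA⟩ := exists_discrete_operator hφtotal hpos S hSV
  have hu1V : ∀ t, MemHs φ lam 1 (u1 t) := fun t => (hu1H2 t).of_le (by norm_num) hpos hmono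
  have hRh_eq : ∀ t, ∀ χ ∈ S, aForm φ lam (Rh (u1 t)) χ = aForm φ lam (u1 t) χ := by
    intro t χ hχ
    have h := hRh _ (hu1V t) χ hχ
    rw [aForm_sub_left hpos (hSV _ (hRh_mem _)) (hu1V t) (hSV _ hχ)] at h
    linarith
  have hPh_eq : ∀ t, ∀ χ ∈ S, ⟪Ph (u2 t), χ⟫ = ⟪u2 t, χ⟫ := by
    intro t χ hχ
    have h := hPh (u2 t) χ hχ
    rw [inner_sub_left] at h
    linarith
  have hau1 : ∀ χ, IntervalIntegrable (fun s => aForm φ lam (u1 s) χ) volume a b := fun χ =>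
    intervalIntegrable_aForm (by norm_num) hpos hab hu1c hu1H2 hu1H2i (memHs_zero hφ χ)
  have hau2 : ∀ χ ∈ S, IntervalIntegrable (fun s => aForm φ lam (u2 s) χ) volume a b :=
    fun χ hχ => intervalIntegrable_aForm (by norm_num) hpos hab hu2c hu2V hu2Vi (hSV χ hχ)
  have hRi : IntervalIntegrable (fun s => Rh (u1 s)) volume a b := by
    refine intervalIntegrable_of_aForm hφtotal hpos hSV (fun s => hRh_mem _) fun χ hχ => ?_
    simp_rw [fun s => hRh_eq s χ hχ]
    exact hau1 χ
  have hPi : IntervalIntegrable (fun s => Ph (u2 s)) volume a b := by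
    have h : ∀ v, Ph v = S.starProjection v := fun v =>
      (Submodule.eq_starProjection_of_mem_of_inner_eq_zero (hPh_mem v) fun w hw => by
        rw [← neg_sub, inner_neg_left, hPh v w hw, neg_zero]).symm
    simp_rw [h]
    refine ContinuousOn.intervalIntegrable ?_
    rw [Set.uIcc_of_le hab]
    exact S.starProjection.continuous.comp_continuousOn hu2c
  have hfi : ∀ χ, IntervalIntegrable (fun s => ⟪f s, χ⟫) volume a b := by
    intro χ
    rw [intervalIntegrable_iff] at hf ⊢
    exact hf.inner_const _
  have hfirst : (∫ s in a..b, aForm φ lam (pderiv q P1 n s) (pval q d1 n s))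
        + aForm φ lam (pval q P1 n a - Rh (u1 a)) (pval q d1 n a)
      = ∫ s in a..b, aForm φ lam (u2 s) (pval q d1 n s) := by
    have hrep : ∀ w ∈ S, ∀ j, aForm φ lam w (d1 n j) = ⟪w, (A ⟨d1 n j, hd1 n j⟩ : H)⟫ :=
      fun w hw j => hA ⟨w, hw⟩ ⟨d1 n j, hd1 n j⟩
    have h := integral_pderiv_add_jump_eq hab q P1 n hRi hP1node hP1orth
      (fun j => (A ⟨d1 n j, hd1 n j⟩ : H)) (fun j s => aForm φ lam (u2 s) (d1 n j))
      (fun j => hau2 _ (hd1 n j)) (fun j => by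
        simp_rw [← fun t => hrep (Rh (u1 t)) (hRh_mem _) j, fun t => hRh_eq t _ (hd1 n j)]
        exact integral_pow_mul_aForm_eq_sub hpos hab (by norm_num) hu1c hu2c hode1 hu1H2 hu2V
          hu1H2i hu2Vi (memHs_zero hφ _) (hSV _ (hd1 n j)) j)
    have hdV := fun j => hSV _ (hd1 n j)
    simp_rw [← fun s => hrep _ (pderiv_mem hP1S q n s),
      ← hrep _ (S.sub_mem (pval_mem hP1S q n a) (hRh_mem (u1 a))),
      ← fun s => aForm_pval_right hpos (hu2V s) q hdV s,
      ← fun s => aForm_pval_right hpos (hSV _ (pderiv_mem hP1S q n s)) q hdV s] at h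
    rw [aForm_pval_right hpos (hSV _ (S.sub_mem (pval_mem hP1S q n a) (hRh_mem (u1 a)))) q hdV]
    exact h
  have hsecond : (∫ s in a..b, ⟪pderiv q P2 n s, pval q d2 n s⟫)
        + ⟪pval q P2 n a - Ph (u2 a), pval q d2 n a⟫
      = ∫ s in a..b, (⟪f s, pval q d2 n s⟫ - aForm φ lam (u1 s) (pval q d2 n s)) := by
    have h := integral_pderiv_add_jump_eq hab q P2 n hPi hP2node hP2orth
      (fun j => d2 n j) (fun j s => ⟪f s, d2 n j⟫ - aForm φ lam (u1 s) (d2 n j))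
      (fun j => (hfi _).sub (hau1 _)) (fun j => by
        simp_rw [fun t => hPh_eq t _ (hd2 n j)]
        refine integral_pow_mul_eq_sub hab (hu2c.inner continuousOn_const) (fun s hs => ?_)
          ((hfi _).sub (hau1 _)) j
        rw [← inner_Aop hφ hφtotal (hu1H2 s), ← inner_sub_left]
        simpa using (hode2 s hs).inner ℝ (hasDerivAt_const s (d2 n j)))
    simp_rw [inner_pval_right, h, fun s => aForm_pval_right hpos (hu1V s) q
      (fun j => hSV _ (hd2 n j)) s, ← Finset.sum_sub_distrib, ← mul_sub]
  have i1 := intervalIntegrable_aForm_pval_of_mem hφtotal hpos hSV (pderiv_mem hP1S q n)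
    ((continuous_pderiv q P1 n).intervalIntegrable a b) q hd1 n
  have i2 := intervalIntegrable_aForm_pval_of_mem hφtotal hpos hSV (pval_mem hP2S q n)
    ((continuous_pval q P2 n).intervalIntegrable a b) q hd1 n
  have i3 := intervalIntegrable_inner_pval
    ((continuous_pderiv q P2 n).intervalIntegrable a b) q d2 n
  have i4 := intervalIntegrable_aForm_pval_of_mem hφtotal hpos hSV (pval_mem hP1S q n)
    ((continuous_pval q P1 n).intervalIntegrable a b) q hd2 n
  have iu2 := intervalIntegrable_aForm_pval hpos hu2V q (fun j => hSV _ (hd1 n j))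
    (fun j => hau2 _ (hd1 n j))
  have iu1 := intervalIntegrable_aForm_pval hpos hu1V q (fun j => hSV _ (hd2 n j))
    (fun j => hau1 (d2 n j))
  have iP := intervalIntegrable_aForm_pval_of_mem hφtotal hpos hSV (fun s => hPh_mem (u2 s))
    hPi q hd1 n
  have iF := intervalIntegrable_inner_pval hf q d2 n
  simp_rw [fun s => aForm_sub_left hpos (hSV _ (pval_mem hP2S q n s)) (hSV _ (hPh_mem (u2 s)))
      (hSV _ (pval_mem hd1 q n s)),
    fun s => aForm_sub_left hpos (hSV _ (pval_mem hP1S q n s)) (hSV _ (hRh_mem (u1 s)))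
      (hSV _ (pval_mem hd2 q n s)),
    fun s => aForm_sub_left hpos (hSV _ (hPh_mem (u2 s))) (hu2V s) (hSV _ (pval_mem hd1 q n s)),
    fun s => hRh_eq s _ (pval_mem hd2 q n s)]
  rw [intervalIntegral.integral_add ((i1.sub i2).add i3) i4,
    intervalIntegral.integral_add (i1.sub i2) i3, intervalIntegral.integral_sub i1 i2,
    intervalIntegral.integral_sub (i2.sub iP) (i4.sub iu1), intervalIntegral.integral_sub i2 iP,
    intervalIntegral.integral_sub i4 iu1, intervalIntegral.integral_sub iP iu2]
  rw [intervalIntegral.integral_sub iF iu1] at hsecond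
  linarith

end DiscreteSpace

/-- **Error equation (6.8) for the full discretization, mixed Ritz/L₂-projected
splitting.** `θ₁ = U₁ - Π_k R_h u₁`, `θ₂ = U₂ - Π_k P_h u₂` (`θ` has coefficient
families `c1 - P1, c2 - P2`), `η₁ = (Π_k - I) R_h u₁`, `η₂ = (Π_k - I) P_h u₂`,
`ω₂ = (P_h - I) u₂`. -/
theorem dGcG_error_equation_mixed
    {H : Type*} [NormedAddCommGroup H] [InnerProductSpace ℝ H] [CompleteSpace H]
    (φ : ℕ → H) (lam : ℕ → ℝ)
    (hφ : Orthonormal ℝ φ)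
    (hφtotal : (Submodule.span ℝ (Set.range φ)).topologicalClosure = ⊤)
    (hlam_pos : ∀ k, 0 < lam k) (hlam_mono : Monotone lam)
    (hlam_top : Filter.Tendsto lam Filter.atTop Filter.atTop)
    (q : ℕ)
    -- the temporal mesh 0 = t₀ < t₁ < ⋯ < t_N = T
    (T : ℝ) (hT : 0 < T) (N : ℕ) (hN : 1 ≤ N)
    (tt : ℕ → ℝ) (ht0 : tt 0 = 0) (htN : tt N = T)
    (htmono : ∀ n < N, tt n < tt (n + 1))
    -- the finite element space S_h ⊂ V
    (S : Submodule ℝ H) (hSfin : FiniteDimensional ℝ S)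
    (hSV : ∀ v ∈ S, MemHs φ lam 1 v)
    -- Ritz projection R_h and L₂-projection P_h
    (Rh Ph : H → H)
    (hRh_mem : ∀ v, Rh v ∈ S)
    (hRh : ∀ v, MemHs φ lam 1 v → ∀ χ ∈ S, aForm φ lam (Rh v - v) χ = 0)
    (hPh_mem : ∀ v, Ph v ∈ S)
    (hPh : ∀ v, ∀ χ ∈ S, ⟪Ph v - v, χ⟫ = 0)
    -- data
    (f : ℝ → H) (hf : IntervalIntegrable f volume 0 T)
    (u0 v0 : H) (hu0 : MemHs φ lam 1 u0)
    -- exact solution (u₁,u₂), with u₁(t) ∈ Ḣ² and u₂(t) ∈ V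
    (u1 u2 : ℝ → H)
    (hu10 : u1 0 = u0) (hu20 : u2 0 = v0)
    (hu1c : ContinuousOn u1 (Set.Icc 0 T)) (hu2c : ContinuousOn u2 (Set.Icc 0 T))
    (hu1H2 : ∀ t, MemHs φ lam 2 (u1 t)) (hu2V : ∀ t, MemHs φ lam 1 (u2 t))
    (hu1H2i : IntervalIntegrable (fun t => hsNorm φ lam 2 (u1 t)) volume 0 T)
    (hu2Vi : IntervalIntegrable (fun t => hsNorm φ lam 1 (u2 t)) volume 0 T)
    (hode1 : ∀ t ∈ Set.Ioo 0 T, HasDerivAt u1 (u2 t) t)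
    (hode2 : ∀ t ∈ Set.Ioo 0 T, HasDerivAt u2 (f t - Aop φ lam (u1 t)) t)
    -- the dG(q)–cG(r) approximation U = (U₁,U₂) ∈ 𝒱_{h,q}
    (c1 c2 : ℕ → ℕ → H)
    (hc1S : ∀ n j, c1 n j ∈ S) (hc2S : ∀ n j, c2 n j ∈ S)
    (hU : ∀ d1 d2 : ℕ → ℕ → H, (∀ n j, d1 n j ∈ S) → (∀ n j, d2 n j ∈ S) →
      Bform φ lam tt N q c1 c2 d1 d2 =
        (∑ n ∈ Finset.Icc 1 N, ∫ s in tt (n-1)..tt n, ⟪f s, pval q d2 n s⟫)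
          + aForm φ lam (Rh u0) (pval q d1 1 (tt 0)) + ⟪Ph v0, pval q d2 1 (tt 0)⟫)
    -- the interpolants Π_k R_h u₁, Π_k P_h u₂ (coefficient families P1, P2)
    (P1 P2 : ℕ → ℕ → H)
    (hP1S : ∀ n j, P1 n j ∈ S) (hP2S : ∀ n j, P2 n j ∈ S)
    (hP1node : ∀ n ∈ Finset.Icc 1 N, pval q P1 n (tt n) = Rh (u1 (tt n)))
    (hP2node : ∀ n ∈ Finset.Icc 1 N, pval q P2 n (tt n) = Ph (u2 (tt n)))
    (hP1orth : ∀ n ∈ Finset.Icc 1 N, ∀ j ∈ Finset.range q,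
      (∫ s in tt (n-1)..tt n, (s ^ j) • (pval q P1 n s - Rh (u1 s))) = 0)
    (hP2orth : ∀ n ∈ Finset.Icc 1 N, ∀ j ∈ Finset.range q,
      (∫ s in tt (n-1)..tt n, (s ^ j) • (pval q P2 n s - Ph (u2 s))) = 0) :
    -- equation (6.8)
    ∀ d1 d2 : ℕ → ℕ → H, (∀ n j, d1 n j ∈ S) → (∀ n j, d2 n j ∈ S) →
      Bform φ lam tt N q (fun n j => c1 n j - P1 n j) (fun n j => c2 n j - P2 n j) d1 d2
        = (∑ n ∈ Finset.Icc 1 N, ∫ s in tt (n-1)..tt n,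
            (aForm φ lam (pval q P2 n s - Ph (u2 s)) (pval q d1 n s)
              - aForm φ lam (pval q P1 n s - Rh (u1 s)) (pval q d2 n s)))
          + (∑ n ∈ Finset.Icc 1 N, ∫ s in tt (n-1)..tt n,
              aForm φ lam (Ph (u2 s) - u2 s) (pval q d1 n s)) := by
  intro d1 d2 hd1 hd2
  have hmono_le : ∀ m n, m ≤ n → n ≤ N → tt m ≤ tt n := by
    intro m n hmn
    induction n, hmn using Nat.le_induction with
    | base => exact fun _ => le_rfl
    | succ k _ ih => exact fun hk => (ih (by omega)).trans (htmono k (by omega)).le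
  have hloc : ∀ n ∈ Finset.Icc 1 N, _ := fun n hn => by
    have hn' := Finset.mem_Icc.1 hn
    have ha : 0 ≤ tt (n - 1) := ht0 ▸ hmono_le 0 (n - 1) (Nat.zero_le _) (by omega)
    have hb : tt n ≤ T := htN ▸ hmono_le n N hn'.2 le_rfl
    have hab : tt (n - 1) ≤ tt n := hmono_le _ _ (by omega) hn'.2
    have hIcc : Set.Icc (tt (n - 1)) (tt n) ⊆ Set.Icc 0 T := Set.Icc_subset_Icc ha hb
    have hIoo : Set.Ioo (tt (n - 1)) (tt n) ⊆ Set.Ioo 0 T := Set.Ioo_subset_Ioo ha hb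
    have huIcc : Set.uIcc (tt (n - 1)) (tt n) ⊆ Set.uIcc 0 T := by
      rwa [Set.uIcc_of_le hab, Set.uIcc_of_le hT.le]
    exact interval_consistency hφ hφtotal hlam_pos hlam_mono q hab hSV hRh_mem hRh hPh_mem hPh
      (hf.mono_set huIcc) (hu1c.mono hIcc) (hu2c.mono hIcc) hu1H2 hu2V (hu1H2i.mono_set huIcc)
      (hu2Vi.mono_set huIcc) (fun t ht => hode1 t (hIoo ht)) (fun t ht => hode2 t (hIoo ht))
      hP1S hP2S hd1 hd2 n (hP1node n hn) (hP2node n hn) (hP1orth n hn) (hP2orth n hn)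
  have hsum := Finset.sum_congr rfl hloc
  rw [Bform_sub_left hφtotal hlam_pos hSV tt N q hc1S hc2S hP1S hP2S hd1 hd2, hU d1 d2 hd1 hd2]
  simp only [Finset.sum_add_distrib, Finset.sum_sub_distrib] at hsum
  obtain ⟨M, rfl⟩ : ∃ M, N = M + 1 := ⟨N - 1, by omega⟩
  have hjump1 : ∑ n ∈ Finset.Icc 1 (M + 1),
        aForm φ lam (pval q P1 n (tt (n - 1)) - Rh (u1 (tt (n - 1)))) (pval q d1 n (tt (n - 1)))
      = aForm φ lam (pval q P1 1 (tt 0)) (pval q d1 1 (tt 0))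
        - aForm φ lam (Rh u0) (pval q d1 1 (tt 0))
        + ∑ n ∈ Finset.Icc 1 M, aForm φ lam (pval q P1 (n + 1) (tt n) - pval q P1 n (tt n))
          (pval q d1 (n + 1) (tt n)) := by
    rw [sum_Icc_one_succ_eq]
    congr 1
    · rw [aForm_sub_left hlam_pos (hSV _ (pval_mem hP1S _ _ _)) (hSV _ (hRh_mem _))
        (hSV _ (pval_mem hd1 _ _ _)), Nat.sub_self, ht0, hu10]
    · refine Finset.sum_congr rfl fun n hn => ?_
      rw [Nat.add_sub_cancel, hP1node n (Finset.Icc_subset_Icc_right (Nat.le_succ M) hn)]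
  have hjump2 : ∑ n ∈ Finset.Icc 1 (M + 1),
        ⟪pval q P2 n (tt (n - 1)) - Ph (u2 (tt (n - 1))), pval q d2 n (tt (n - 1))⟫
      = ⟪pval q P2 1 (tt 0), pval q d2 1 (tt 0)⟫ - ⟪Ph v0, pval q d2 1 (tt 0)⟫
        + ∑ n ∈ Finset.Icc 1 M, ⟪pval q P2 (n + 1) (tt n) - pval q P2 n (tt n),
          pval q d2 (n + 1) (tt n)⟫ := by
    rw [sum_Icc_one_succ_eq]
    congr 1
    · rw [inner_sub_left, Nat.sub_self, ht0, hu20]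
    · refine Finset.sum_congr rfl fun n hn => ?_
      rw [Nat.add_sub_cancel, hP2node n (Finset.Icc_subset_Icc_right (Nat.le_succ M) hn)]
  rw [hjump1, hjump2] at hsum
  rw [Bform, Nat.add_sub_cancel, Finset.sum_add_distrib]
  linarith
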